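/- arXiv:1611.04921 — 2 statements merged into one kernel-verified Lean document; each statement's English description precedes it below -/
import Mathlib

section
/- Let X₁,…,Xₙ be independent Gaussian mixtures, where Xᵢ has the same distribution as YᵢZᵢ with Yᵢ positive and Zᵢ a standard Gaussian independent of Yᵢ. Let μᵢ be the law of Xᵢ and μ = μ₁ × ⋯ × μₙ. If additionally log Yᵢ is a log-concave random variable for each i, then for every symmetric convex set K ⊆ ℝⁿ, the function (t₁,…,tₙ) ↦ μ(Δ(e^{t₁},…,e^{tₙ})K) is log-concave on ℝⁿ, where Δ(s₁,…,sₙ) denotes the diagonal n×n matrix with diagonal entries s₁,…,sₙ. -/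
open MeasureTheory ProbabilityTheory
open scoped Pointwise ENNReal

/-- A measure `μ` is log-concave if `μ(λA + (1-λ)B) ≥ μ(A)^λ μ(B)^{1-λ}` for all Borel
sets `A, B` and `λ ∈ (0,1)`. -/
def IsLogConcaveMeasure {E : Type*} [AddCommGroup E] [Module ℝ E] [MeasurableSpace E]
    (μ : Measure E) : Prop :=
  ∀ A B : Set E, MeasurableSet A → MeasurableSet B → ∀ l : ℝ, 0 < l → l < 1 →
    μ A ^ l * μ B ^ (1 - l) ≤ μ (l • A + (1 - l) • B)

open Set Filter Topology

/-- The functional Prékopa–Leindler inequality for a measure. -/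
def SatisfiesPrekopaLeindler {E : Type*} [AddCommGroup E] [Module ℝ E] [MeasurableSpace E]
    (ρ : Measure E) : Prop :=
  ∀ l : ℝ, 0 < l → l < 1 → ∀ f g h : E → ℝ≥0∞, Measurable f → Measurable g → Measurable h →
    (∀ x y, f x ^ l * g y ^ (1 - l) ≤ h (l • x + (1 - l) • y)) →
    (∫⁻ x, f x ∂ρ) ^ l * (∫⁻ x, g x ∂ρ) ^ (1 - l) ≤ ∫⁻ x, h x ∂ρ

lemma lintegral_eq_lintegral_measure_ofReal_lt {α : Type*} [MeasurableSpace α] (ρ : Measure α)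
    [SFinite ρ] {f : α → ℝ≥0∞} (hf : Measurable f) :
    ∫⁻ x, f x ∂ρ = ∫⁻ s in Ioi (0 : ℝ), ρ {x | ENNReal.ofReal s < f x} := by
  have hS : MeasurableSet {p : ℝ × α | ENNReal.ofReal p.1 < f p.2} :=
    measurableSet_lt (ENNReal.measurable_ofReal.comp measurable_fst) (hf.comp measurable_snd)
  have h1 : ∀ c : ℝ≥0∞, ∫⁻ s in Ioi (0 : ℝ), {s | ENNReal.ofReal s < c}.indicator 1 s = c := by
    intro c
    rw [lintegral_indicator_one (measurableSet_lt ENNReal.measurable_ofReal measurable_const),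
      Measure.restrict_apply (measurableSet_lt ENNReal.measurable_ofReal measurable_const)]
    rcases eq_or_ne c ∞ with rfl | hc
    · simp
    · have : {s | ENNReal.ofReal s < c} ∩ Ioi (0 : ℝ) = Ioo 0 c.toReal := by
        ext s
        simp only [mem_inter_iff, mem_ofPred_eq, mem_Ioi, mem_Ioo]
        constructor
        · rintro ⟨h, h0⟩
          exact ⟨h0, (ENNReal.ofReal_lt_iff_lt_toReal h0.le hc).1 h⟩
        · rintro ⟨h0, h⟩
          exact ⟨(ENNReal.ofReal_lt_iff_lt_toReal h0.le hc).2 h, h0⟩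
      rw [this, Real.volume_Ioo, sub_zero, ENNReal.ofReal_toReal hc]
  calc ∫⁻ x, f x ∂ρ
      = ∫⁻ x, (∫⁻ s in Ioi (0 : ℝ), {s | ENNReal.ofReal s < f x}.indicator 1 s) ∂ρ := by
        simp_rw [h1]
    _ = ∫⁻ s in Ioi (0 : ℝ), ∫⁻ x, {s | ENNReal.ofReal s < f x}.indicator 1 s ∂ρ := by
        refine lintegral_lintegral_swap (Measurable.aemeasurable ?_)
        exact (measurable_one.indicator hS).comp measurable_swap
    _ = _ := by
        refine lintegral_congr fun s => ?_
        have : (fun x => {s | ENNReal.ofReal s < f x}.indicator (1 : ℝ → ℝ≥0∞) s)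
            = {x | ENNReal.ofReal s < f x}.indicator 1 := by
          ext x; simp [indicator]
        rw [this, lintegral_indicator_one (measurableSet_lt measurable_const hf)]

/-- The one-dimensional Brunn–Minkowski inequality. -/
lemma Real.volume_add_volume_le_volume_add {A B : Set ℝ} (hA : MeasurableSet A)
    (hB : MeasurableSet B) (hA0 : A.Nonempty) (hB0 : B.Nonempty) :
    volume A + volume B ≤ volume (A + B) := by
  have key : ∀ K L : Set ℝ, IsCompact K → IsCompact L → K.Nonempty → L.Nonempty →
      volume K + volume L ≤ volume (K + L) := by
    intro K L hK hL hK0 hL0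
    have hm := hK.sSup_mem hK0
    have hn := hL.sInf_mem hL0
    set m := sSup K
    set k := sInf L
    have hd : AEDisjoint volume (K + {k}) ({m} + L) := by
      refine measure_mono_null (t := {m + k}) ?_ (by simp)
      rintro _ ⟨⟨x, hx, _, rfl, rfl⟩, ⟨_, rfl, y, hy, hxy⟩⟩
      have h1 : x ≤ m := le_csSup hK.bddAbove hx
      have h2 : k ≤ y := csInf_le hL.bddBelow hy
      simp only [mem_singleton_iff] at hxy ⊢
      linarith
    calc volume K + volume L = volume (K + {k}) + volume ({m} + L) := by
          rw [add_singleton, singleton_add]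
          simp
      _ = volume ((K + {k}) ∪ ({m} + L)) := by
          refine (measure_union₀ ?_ hd).symm
          exact (isCompact_singleton.add hL).measurableSet.nullMeasurableSet
      _ ≤ volume (K + L) := by
          refine measure_mono (union_subset (add_subset_add_left ?_) (add_subset_add_right ?_)) <;>
          simpa
  obtain ⟨a, ha⟩ := hA0
  obtain ⟨b, hb⟩ := hB0
  rw [hA.measure_eq_iSup_isCompact, hB.measure_eq_iSup_isCompact]
  simp only [iSup_and']
  refine ENNReal.biSup_add_biSup_le' ⟨∅, empty_subset _, isCompact_empty⟩
    ⟨∅, empty_subset _, isCompact_empty⟩ ?_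
  rintro K ⟨hKA, hK⟩ L ⟨hLB, hL⟩
  refine le_trans ?_ ((key (insert a K) (insert b L) (hK.insert a) (hL.insert b)
    (insert_nonempty _ _) (insert_nonempty _ _)).trans (measure_mono ?_))
  · exact add_le_add (measure_mono (subset_insert _ _)) (measure_mono (subset_insert _ _))
  · exact add_subset_add (insert_subset ha hKA) (insert_subset hb hLB)

lemma ENNReal.geom_mean_le_arith_mean₂ {l : ℝ} (h0 : 0 < l) (h1 : l < 1) (a b : ℝ≥0∞) :
    a ^ l * b ^ (1 - l) ≤ ENNReal.ofReal l * a + ENNReal.ofReal (1 - l) * b := by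
  have h1' : 0 < 1 - l := by linarith
  have hpq : (l⁻¹).HolderConjugate (1 - l)⁻¹ := by
    rw [Real.holderConjugate_iff]
    exact ⟨(one_lt_inv₀ h0).2 h1, by simp⟩
  have := ENNReal.young_inequality (a ^ l) (b ^ (1 - l)) hpq
  rw [← ENNReal.rpow_mul, ← ENNReal.rpow_mul, mul_inv_cancel₀ h0.ne', mul_inv_cancel₀ h1'.ne',
    ENNReal.rpow_one, ENNReal.rpow_one, ENNReal.ofReal_inv_of_pos h0,
    ENNReal.ofReal_inv_of_pos h1', div_eq_mul_inv, div_eq_mul_inv, inv_inv, inv_inv] at this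
  rwa [mul_comm (ENNReal.ofReal l), mul_comm (ENNReal.ofReal (1 - l))]

lemma Real.mul_lintegral_add_mul_lintegral_le {l : ℝ} (h0 : 0 < l) (h1 : l < 1)
    {f g h : ℝ → ℝ≥0∞} (hf : Measurable f) (hg : Measurable g) (hh : Measurable h)
    (hfgh : ∀ x y, f x ^ l * g y ^ (1 - l) ≤ h (l • x + (1 - l) • y))
    (hf1 : ⨆ x, f x = 1) (hg1 : ⨆ x, g x = 1) :
    ENNReal.ofReal l * (∫⁻ x, f x) + ENNReal.ofReal (1 - l) * (∫⁻ x, g x) ≤ ∫⁻ x, h x := by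
  have h1' : 0 < 1 - l := by linarith
  rw [lintegral_eq_lintegral_measure_ofReal_lt _ hf, lintegral_eq_lintegral_measure_ofReal_lt _ hg,
    lintegral_eq_lintegral_measure_ofReal_lt _ hh, ← lintegral_const_mul' _ _ ENNReal.ofReal_ne_top,
    ← lintegral_const_mul' _ _ ENNReal.ofReal_ne_top]
  refine (le_lintegral_add _ _).trans (lintegral_mono fun s => ?_)
  dsimp only
  rcases le_or_gt 1 (ENNReal.ofReal s) with hs | hs
  · have e : ∀ k : ℝ → ℝ≥0∞, ⨆ x, k x = 1 → {x | ENNReal.ofReal s < k x} = ∅ := by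
      intro k hk
      ext x
      simpa using (hk ▸ le_iSup k x).trans hs
    simp [e f hf1, e g hg1]
  · have e : ∀ k : ℝ → ℝ≥0∞, ⨆ x, k x = 1 → {x | ENNReal.ofReal s < k x}.Nonempty := by
      intro k hk
      exact lt_iSup_iff.1 (hk ▸ hs)
    have hA := measurableSet_lt (measurable_const (a := ENNReal.ofReal s)) hf
    have hB := measurableSet_lt (measurable_const (a := ENNReal.ofReal s)) hg
    have := Real.volume_add_volume_le_volume_add (hA.const_smul₀ l) (hB.const_smul₀ (1 - l))
      ((e f hf1).smul_set) ((e g hg1).smul_set)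
    rw [Measure.addHaar_smul, Measure.addHaar_smul] at this
    simp only [Module.finrank_self, pow_one, abs_of_pos h0, abs_of_pos h1'] at this
    refine this.trans (measure_mono ?_)
    rintro _ ⟨_, ⟨x, hx, rfl⟩, _, ⟨y, hy, rfl⟩, rfl⟩
    simp only [mem_ofPred_eq] at hx hy ⊢
    refine lt_of_lt_of_le ?_ (hfgh x y)
    calc ENNReal.ofReal s = ENNReal.ofReal s ^ l * ENNReal.ofReal s ^ (1 - l) := by
          rw [← ENNReal.rpow_add_of_nonneg _ _ h0.le h1'.le]; simp
      _ < _ := ENNReal.mul_lt_mul (ENNReal.rpow_lt_rpow hx h0) (ENNReal.rpow_lt_rpow hy h1')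

lemma Real.prekopaLeindler_of_iSup_ne_top {l : ℝ} (h0 : 0 < l) (h1 : l < 1)
    {f g h : ℝ → ℝ≥0∞} (hf : Measurable f) (hg : Measurable g) (hh : Measurable h)
    (hfgh : ∀ x y, f x ^ l * g y ^ (1 - l) ≤ h (l • x + (1 - l) • y))
    (hf1 : ⨆ x, f x ≠ ∞) (hg1 : ⨆ x, g x ≠ ∞) :
    (∫⁻ x, f x) ^ l * (∫⁻ x, g x) ^ (1 - l) ≤ ∫⁻ x, h x := by
  have h1' : 0 < 1 - l := by linarith
  set a := ⨆ x, f x with ha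
  set b := ⨆ x, g x with hb
  rcases eq_or_ne a 0 with ha0 | ha0
  · have : f = 0 := by
      ext x; simpa using (le_iSup f x).trans ha0.le
    simp [this, h0]
  rcases eq_or_ne b 0 with hb0 | hb0
  · have : g = 0 := by
      ext x; simpa using (le_iSup g x).trans hb0.le
    simp [this, h1']
  have hc0 : a ^ l * b ^ (1 - l) ≠ 0 := by
    simp [ha0, hb0, hf1, hg1]
  have hct : a ^ l * b ^ (1 - l) ≠ ∞ :=
    ENNReal.mul_ne_top (ENNReal.rpow_ne_top_of_nonneg h0.le hf1)
      (ENNReal.rpow_ne_top_of_nonneg h1'.le hg1)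
  have hscale : ∀ u v : ℝ≥0∞, (a⁻¹ * u) ^ l * (b⁻¹ * v) ^ (1 - l) =
      (a ^ l * b ^ (1 - l))⁻¹ * (u ^ l * v ^ (1 - l)) := by
    intro u v
    rw [ENNReal.mul_rpow_of_nonneg _ _ h0.le, ENNReal.mul_rpow_of_nonneg _ _ h1'.le,
      ENNReal.mul_inv (Or.inr (ENNReal.rpow_ne_top_of_nonneg h1'.le hg1))
        (Or.inl (ENNReal.rpow_ne_top_of_nonneg h0.le hf1)), ENNReal.inv_rpow, ENNReal.inv_rpow]
    ring
  have key := Real.mul_lintegral_add_mul_lintegral_le h0 h1 (hf.const_mul a⁻¹) (hg.const_mul b⁻¹)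
    (hh.const_mul (a ^ l * b ^ (1 - l))⁻¹)
    (fun x y => by rw [hscale]; gcongr; exact hfgh x y)
    (by rw [← ENNReal.mul_iSup, ← ha, ENNReal.inv_mul_cancel ha0 hf1])
    (by rw [← ENNReal.mul_iSup, ← hb, ENNReal.inv_mul_cancel hb0 hg1])
  have := (ENNReal.geom_mean_le_arith_mean₂ h0 h1 _ _).trans key
  rw [lintegral_const_mul _ hf, lintegral_const_mul _ hg, lintegral_const_mul _ hh, hscale] at this
  exact (ENNReal.mul_le_mul_iff_right (ENNReal.inv_ne_zero.2 hct) (ENNReal.inv_ne_top.2 hc0)).1 this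

lemma lintegral_eq_iSup_lintegral_min_natCast {α : Type*} [MeasurableSpace α] (ρ : Measure α)
    {f : α → ℝ≥0∞} (hf : Measurable f) :
    ∫⁻ x, f x ∂ρ = ⨆ k : ℕ, ∫⁻ x, min (f x) k ∂ρ := by
  rw [← lintegral_iSup (fun k => hf.min measurable_const)]
  · refine lintegral_congr fun x => ?_
    rw [← inf_iSup_eq, ENNReal.iSup_natCast, inf_top_eq]
  · intro i j hij x
    exact min_le_min le_rfl (Nat.cast_le.2 hij)

/-- The one-dimensional Prékopa–Leindler inequality for the Lebesgue measure. -/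
theorem Real.satisfiesPrekopaLeindler_volume : SatisfiesPrekopaLeindler (volume : Measure ℝ) := by
  intro l h0 h1 f g h hf hg hh hfgh
  have h1' : 0 < 1 - l := by linarith
  have hmono : ∀ k : ℝ → ℝ≥0∞, Monotone fun N : ℕ => ∫⁻ x, min (k x) N := fun k i j hij =>
    lintegral_mono fun x => min_le_min le_rfl (Nat.cast_le.2 hij)
  rw [lintegral_eq_iSup_lintegral_min_natCast _ hf, lintegral_eq_iSup_lintegral_min_natCast _ hg,
    ← ENNReal.orderIsoRpow_apply l h0, ← ENNReal.orderIsoRpow_apply (1 - l) h1',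
    OrderIso.map_iSup, OrderIso.map_iSup]
  simp_rw [ENNReal.iSup_mul, ENNReal.mul_iSup]
  refine iSup₂_le fun i j => ?_
  set N := max i j
  refine le_trans (mul_le_mul' ((ENNReal.orderIsoRpow l h0).monotone (hmono f (le_max_left i j)))
    ((ENNReal.orderIsoRpow (1 - l) h1').monotone (hmono g (le_max_right i j)))) ?_
  refine Real.prekopaLeindler_of_iSup_ne_top h0 h1 (hf.min measurable_const)
    (hg.min measurable_const) hh (fun x y => le_trans ?_ (hfgh x y)) ?_ ?_
  · gcongr <;> exact min_le_left _ _
  · exact ne_top_of_le_ne_top (ENNReal.natCast_ne_top N) (iSup_le fun x => min_le_right _ _)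
  · exact ne_top_of_le_ne_top (ENNReal.natCast_ne_top N) (iSup_le fun x => min_le_right _ _)

lemma lintegral_Ioi_eq_lintegral_exp (F : ℝ → ℝ≥0∞) :
    ∫⁻ s in Ioi (0 : ℝ), F s = ∫⁻ a, ENNReal.ofReal (Real.exp a) * F (Real.exp a) := by
  have := lintegral_image_eq_lintegral_abs_deriv_mul (s := univ) MeasurableSet.univ
    (fun x _ => (Real.hasDerivAt_exp x).hasDerivWithinAt) Real.exp_injective.injOn F
  simpa [image_univ, Real.range_exp] using this

/-- A log-concave measure satisfies the functional Prékopa–Leindler inequality. -/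
theorem IsLogConcaveMeasure.satisfiesPrekopaLeindler {E : Type*} [AddCommGroup E] [Module ℝ E]
    [MeasurableSpace E] {ρ : Measure E} [SFinite ρ] (hρ : IsLogConcaveMeasure ρ) :
    SatisfiesPrekopaLeindler ρ := by
  intro l h0 h1 f g h hf hg hh hfgh
  have h1' : 0 < 1 - l := by linarith
  have hmeas : ∀ k : E → ℝ≥0∞, Measurable fun a : ℝ =>
      ENNReal.ofReal (Real.exp a) * ρ {x | ENNReal.ofReal (Real.exp a) < k x} := by
    intro k
    have : Antitone fun a : ℝ => ρ {x | ENNReal.ofReal (Real.exp a) < k x} := by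
      intro a b hab
      refine measure_mono fun x hx => ?_
      simp only [mem_ofPred_eq] at hx ⊢
      exact (ENNReal.ofReal_le_ofReal (Real.exp_le_exp.2 hab)).trans_lt hx
    exact (ENNReal.measurable_ofReal.comp Real.measurable_exp).mul this.measurable
  have hexp : ∀ a b : ℝ, ENNReal.ofReal (Real.exp a) ^ l * ENNReal.ofReal (Real.exp b) ^ (1 - l) =
      ENNReal.ofReal (Real.exp (l • a + (1 - l) • b)) := by
    intro a b
    rw [ENNReal.ofReal_rpow_of_pos (Real.exp_pos a), ENNReal.ofReal_rpow_of_pos (Real.exp_pos b),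
      ← ENNReal.ofReal_mul (by positivity), ← Real.exp_mul, ← Real.exp_mul, ← Real.exp_add]
    simp only [smul_eq_mul, mul_comm]
  rw [lintegral_eq_lintegral_measure_ofReal_lt _ hf, lintegral_eq_lintegral_measure_ofReal_lt _ hg,
    lintegral_eq_lintegral_measure_ofReal_lt _ hh, lintegral_Ioi_eq_lintegral_exp,
    lintegral_Ioi_eq_lintegral_exp, lintegral_Ioi_eq_lintegral_exp]
  refine Real.satisfiesPrekopaLeindler_volume l h0 h1 _ _ _ (hmeas f) (hmeas g) (hmeas h) ?_
  intro a b
  rw [ENNReal.mul_rpow_of_nonneg _ _ h0.le, ENNReal.mul_rpow_of_nonneg _ _ h1'.le,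
    mul_mul_mul_comm, hexp]
  gcongr
  refine (hρ _ _ (measurableSet_lt measurable_const hf) (measurableSet_lt measurable_const hg)
    l h0 h1).trans (measure_mono ?_)
  rintro _ ⟨_, ⟨x, hx, rfl⟩, _, ⟨y, hy, rfl⟩, rfl⟩
  simp only [mem_ofPred_eq] at hx hy ⊢
  refine lt_of_lt_of_le ?_ (hfgh x y)
  rw [← hexp]
  exact ENNReal.mul_lt_mul (ENNReal.rpow_lt_rpow hx h0) (ENNReal.rpow_lt_rpow hy h1')

lemma SatisfiesPrekopaLeindler.prod {E F : Type*} [AddCommGroup E] [Module ℝ E]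
    [MeasurableSpace E] [AddCommGroup F] [Module ℝ F] [MeasurableSpace F]
    {ρ : Measure E} {σ : Measure F} [SFinite σ]
    (hρ : SatisfiesPrekopaLeindler ρ) (hσ : SatisfiesPrekopaLeindler σ) :
    SatisfiesPrekopaLeindler (ρ.prod σ) := by
  intro l h0 h1 f g h hf hg hh hfgh
  rw [lintegral_prod _ hf.aemeasurable, lintegral_prod _ hg.aemeasurable,
    lintegral_prod _ hh.aemeasurable]
  refine hρ l h0 h1 _ _ _ hf.lintegral_prod_right' hg.lintegral_prod_right'
    hh.lintegral_prod_right' fun x y => ?_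
  exact hσ l h0 h1 _ _ _ (hf.comp measurable_prodMk_left) (hg.comp measurable_prodMk_left)
    (hh.comp measurable_prodMk_left) fun x' y' => hfgh (x, x') (y, y')

lemma SatisfiesPrekopaLeindler.map {E F : Type*} [AddCommGroup E] [Module ℝ E]
    [MeasurableSpace E] [AddCommGroup F] [Module ℝ F] [MeasurableSpace F]
    {ρ : Measure E} (hρ : SatisfiesPrekopaLeindler ρ) (T : E →ₗ[ℝ] F) (hT : Measurable T) :
    SatisfiesPrekopaLeindler (ρ.map T) := by
  intro l h0 h1 f g h hf hg hh hfgh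
  rw [lintegral_map hf hT, lintegral_map hg hT, lintegral_map hh hT]
  refine hρ l h0 h1 _ _ _ (hf.comp hT) (hg.comp hT) (hh.comp hT) fun x y => ?_
  simpa using hfgh (T x) (T y)

theorem SatisfiesPrekopaLeindler.pi {n : ℕ} {ρ : Fin n → Measure ℝ} [∀ i, SigmaFinite (ρ i)]
    (hρ : ∀ i, SatisfiesPrekopaLeindler (ρ i)) : SatisfiesPrekopaLeindler (Measure.pi ρ) := by
  induction n with
  | zero =>
    intro l h0 h1 f g h hf hg hh hfgh
    rw [Measure.pi_of_empty ρ 0, lintegral_dirac' _ hf, lintegral_dirac' _ hg,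
      lintegral_dirac' _ hh]
    simpa using hfgh 0 0
  | succ n ih =>
    have hpres := (measurePreserving_piFinSuccAbove ρ 0).symm
    let T : ℝ × (Fin n → ℝ) →ₗ[ℝ] (Fin (n + 1) → ℝ) :=
      { toFun := fun p => Fin.cons p.1 p.2
        map_add' := fun p q => by
          ext i; refine Fin.cases ?_ (fun j => ?_) i <;> simp
        map_smul' := fun c p => by
          ext i; refine Fin.cases ?_ (fun j => ?_) i <;> simp }
    have hTe : (T : ℝ × (Fin n → ℝ) → (Fin (n + 1) → ℝ)) =
        (MeasurableEquiv.piFinSuccAbove (fun _ => ℝ) 0).symm := by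
      ext p i
      simp [T, MeasurableEquiv.piFinSuccAbove, Fin.insertNthEquiv]
    rw [← hpres.map_eq, ← hTe]
    exact ((hρ 0).prod (ih fun i => hρ _)).map T (hTe ▸ hpres.measurable)

lemma lintegral_fin_prod_eq_prod {n : ℕ} (ρ : Fin n → Measure ℝ) [∀ i, SigmaFinite (ρ i)]
    {f : Fin n → ℝ → ℝ≥0∞} (hf : ∀ i, Measurable (f i)) :
    ∫⁻ x, ∏ i, f i (x i) ∂(Measure.pi ρ) = ∏ i, ∫⁻ y, f i y ∂(ρ i) := by
  induction n with
  | zero => simp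
  | succ n ih =>
    have hm : Measurable fun x : Fin (n + 1) → ℝ => ∏ i, f i (x i) := by fun_prop
    have hm' : Measurable fun x : Fin n → ℝ => ∏ i, f (Fin.succ i) (x i) := by fun_prop
    rw [← (measurePreserving_piFinSuccAbove ρ 0).symm.lintegral_comp hm]
    simp only [Fin.prod_univ_succ, MeasurableEquiv.piFinSuccAbove_symm_apply, Fin.insertNthEquiv,
      Equiv.coe_fn_mk, Fin.insertNth_zero', Fin.cons_zero, Fin.cons_succ]
    rw [lintegral_prod_mul (hf 0).aemeasurable hm'.aemeasurable]
    exact congrArg _ (ih _ fun i => hf i.succ)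

/-- The unnormalised density `exp (-∑ aᵢ xᵢ² / 2)` of a diagonal Gaussian. -/
noncomputable def gaussWeight {n : ℕ} (a x : Fin n → ℝ) : ℝ≥0∞ :=
  ENNReal.ofReal (Real.exp (-(∑ i, a i * x i ^ 2) / 2))

lemma measurable_gaussWeight {n : ℕ} (a : Fin n → ℝ) : Measurable (gaussWeight a) := by
  unfold gaussWeight
  fun_prop

lemma gaussWeight_ne_top {n : ℕ} (a x : Fin n → ℝ) : gaussWeight a x ≠ ∞ :=
  ENNReal.ofReal_ne_top

lemma gaussWeight_mono {n : ℕ} {a b : Fin n → ℝ} (h : a ≤ b) (x : Fin n → ℝ) :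
    gaussWeight b x ≤ gaussWeight a x := by
  unfold gaussWeight
  gcongr
  exact h _

lemma gaussWeight_eq_prod {n : ℕ} (a x : Fin n → ℝ) :
    gaussWeight a x = ∏ i, ENNReal.ofReal (Real.exp (-(a i / 2) * x i ^ 2)) := by
  rw [gaussWeight, ← ENNReal.ofReal_prod_of_nonneg fun i _ => (Real.exp_pos _).le, ← Real.exp_sum]
  congr 2
  rw [neg_div, Finset.sum_div, ← Finset.sum_neg_distrib]
  exact Finset.sum_congr rfl fun i _ => by ring

lemma lintegral_gaussWeight_ne_top {n : ℕ} {a : Fin n → ℝ} (ha : ∀ i, 0 < a i) :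
    ∫⁻ x, gaussWeight a x ≠ ∞ := by
  simp_rw [gaussWeight_eq_prod]
  rw [volume_pi, lintegral_fin_prod_eq_prod _ (f := fun i y =>
    ENNReal.ofReal (Real.exp (-(a i / 2) * y ^ 2))) fun i => by fun_prop]
  refine ENNReal.prod_ne_top fun i _ => ?_
  exact (integrable_exp_neg_mul_sq (half_pos (ha i))).lintegral_lt_top.ne

/-- Anderson's inequality for a diagonal Gaussian. -/
lemma setLIntegral_gaussWeight_add_le {n : ℕ} {a : Fin n → ℝ} (ha : ∀ i, 0 ≤ a i)
    {L : Set (Fin n → ℝ)} (hLm : MeasurableSet L) (hL : Convex ℝ L) (hneg : ∀ x ∈ L, -x ∈ L)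
    (w : Fin n → ℝ) :
    ∫⁻ v in L, gaussWeight a (v + w) ≤ ∫⁻ v in L, gaussWeight a v := by
  have hPL : SatisfiesPrekopaLeindler (volume : Measure (Fin n → ℝ)) :=
    SatisfiesPrekopaLeindler.pi fun _ => Real.satisfiesPrekopaLeindler_volume
  have hw := measurable_gaussWeight a
  have hmem : ∀ v, -v ∈ L ↔ v ∈ L := fun v => ⟨fun h => by simpa using hneg _ h, hneg v⟩
  have hsymm : ∫⁻ v, L.indicator (fun v => gaussWeight a (v - w)) v =
      ∫⁻ v, L.indicator (fun v => gaussWeight a (v + w)) v := by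
    refine (lintegral_neg_eq_self _).symm.trans ?_
    refine lintegral_congr fun v => ?_
    by_cases hv : v ∈ L
    · rw [indicator_of_mem ((hmem v).2 hv), indicator_of_mem hv]
      simp only [gaussWeight, Pi.sub_apply, Pi.add_apply, Pi.neg_apply]
      congr 4
      exact Finset.sum_congr rfl fun i _ => by ring
    · rw [indicator_of_notMem (mt (hmem v).1 hv), indicator_of_notMem hv]
  have key := hPL (1 / 2) (by norm_num) (by norm_num)
    (L.indicator fun v => gaussWeight a (v + w)) (L.indicator fun v => gaussWeight a (v - w))
    (L.indicator (gaussWeight a)) ((hw.comp (measurable_add_const w)).indicator hLm)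
    ((hw.comp (measurable_sub_const w)).indicator hLm) (hw.indicator hLm) ?_
  · rw [hsymm, ← ENNReal.rpow_add_of_nonneg _ _ (by norm_num) (by norm_num)] at key
    norm_num at key
    rwa [lintegral_indicator hLm, lintegral_indicator hLm] at key
  · intro x y
    by_cases hx : x ∈ L
    · by_cases hy : y ∈ L
      · have hxy : (1 / 2 : ℝ) • x + (1 - 1 / 2 : ℝ) • y ∈ L :=
          hL hx hy (by norm_num) (by norm_num) (by norm_num)
        rw [indicator_of_mem hx, indicator_of_mem hy, indicator_of_mem hxy]
        simp only [gaussWeight]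
        rw [ENNReal.ofReal_rpow_of_pos (Real.exp_pos _), ENNReal.ofReal_rpow_of_pos
          (Real.exp_pos _), ← ENNReal.ofReal_mul (by positivity), ← Real.exp_mul, ← Real.exp_mul,
          ← Real.exp_add]
        refine ENNReal.ofReal_le_ofReal (Real.exp_le_exp.2 ?_)
        have : ∑ i, a i * ((1 / 2 : ℝ) • x + (1 - 1 / 2 : ℝ) • y) i ^ 2 ≤
            ∑ i, (a i * (x + w) i ^ 2 / 2 + a i * (y - w) i ^ 2 / 2) := by
          refine Finset.sum_le_sum fun i _ => ?_
          simp only [Pi.add_apply, Pi.sub_apply, Pi.smul_apply, smul_eq_mul]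
          nlinarith [mul_nonneg (ha i) (sq_nonneg (x i + w i - (y i - w i)))]
        rw [Finset.sum_add_distrib, ← Finset.sum_div, ← Finset.sum_div] at this
        linarith
      · simp only [indicator_of_notMem hy]
        norm_num
    · simp [hx]

/-- The rotation `(x, y) ↦ ((x + y) / √2, (x - y) / √2)`. -/
noncomputable def rotHalf (n : ℕ) :
    ((Fin n → ℝ) × (Fin n → ℝ)) →ₗ[ℝ] ((Fin n → ℝ) × (Fin n → ℝ)) :=
  (√2)⁻¹ • ((LinearMap.fst ℝ _ _ + LinearMap.snd ℝ _ _).prod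
    (LinearMap.fst ℝ _ _ - LinearMap.snd ℝ _ _))

lemma rotHalf_apply {n : ℕ} (p : (Fin n → ℝ) × (Fin n → ℝ)) :
    rotHalf n p = ((√2)⁻¹ • (p.1 + p.2), (√2)⁻¹ • (p.1 - p.2)) := rfl

lemma rotHalf_rotHalf {n : ℕ} (p : (Fin n → ℝ) × (Fin n → ℝ)) : rotHalf n (rotHalf n p) = p := by
  have h : (√2)⁻¹ * (√2)⁻¹ = (2 : ℝ)⁻¹ := by
    rw [← mul_inv, Real.mul_self_sqrt zero_le_two]
  rw [rotHalf_apply, rotHalf_apply]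
  ext i
  · simp only [Pi.add_apply, Pi.sub_apply, Pi.smul_apply, smul_eq_mul]
    linear_combination (2 * p.1 i) * h
  · simp only [Pi.add_apply, Pi.sub_apply, Pi.smul_apply, smul_eq_mul]
    linear_combination (2 * p.2 i) * h

lemma measurePreserving_rotHalf (n : ℕ) : MeasurePreserving (rotHalf n) volume volume := by
  have hdet : LinearMap.det (rotHalf n) * LinearMap.det (rotHalf n) = 1 := by
    rw [← LinearMap.det_comp, ← LinearMap.det_id (M := (Fin n → ℝ) × (Fin n → ℝ))]
    congr 1
    exact LinearMap.ext rotHalf_rotHalf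
  have h0 : LinearMap.det (rotHalf n) ≠ 0 := fun h => by simp [h] at hdet
  have : Measure.IsAddHaarMeasure (volume : Measure ((Fin n → ℝ) × (Fin n → ℝ))) :=
    Measure.prod.instIsAddHaarMeasure (volume : Measure (Fin n → ℝ)) (volume : Measure (Fin n → ℝ))
  refine ⟨(LinearMap.continuous_of_finiteDimensional _).measurable, ?_⟩
  rw [Measure.map_linearMap_addHaar_eq_smul_addHaar _ h0]
  have habs : |LinearMap.det (rotHalf n)| = 1 := by
    rcases mul_self_eq_one_iff.1 hdet with h | h <;> simp [h]
  simp [abs_inv, habs]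

/-- Sets symmetric under the exchange `(x, y) ↦ (y, x)` and the reflection `(x, y) ↦ (x, -y)`. -/
structure IsDoublySymmetric {E : Type*} [AddCommGroup E] (S : Set (E × E)) : Prop where
  swap_mem : ∀ p ∈ S, p.swap ∈ S
  neg_snd_mem : ∀ p ∈ S, (p.1, -p.2) ∈ S

lemma IsDoublySymmetric.preimage_rotHalf {n : ℕ} {S : Set ((Fin n → ℝ) × (Fin n → ℝ))}
    (hS : IsDoublySymmetric S) : IsDoublySymmetric (rotHalf n ⁻¹' S) where
  swap_mem p hp := by
    have := hS.neg_snd_mem _ hp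
    simpa [rotHalf_apply, add_comm, ← smul_neg] using this
  neg_snd_mem p hp := by
    have := hS.swap_mem _ hp
    simpa [rotHalf_apply, ← sub_eq_add_neg] using this

/-- One rotation step replaces the pair of covariance parameters by their harmonic and
arithmetic means. -/
lemma setLIntegral_gaussWeight_mul_le {n : ℕ} {S : Set ((Fin n → ℝ) × (Fin n → ℝ))}
    (hSm : MeasurableSet S) (hSc : Convex ℝ S) (hS : IsDoublySymmetric S)
    {a b : Fin n → ℝ} (ha : ∀ i, 0 < a i) (hb : ∀ i, 0 < b i) :
    ∫⁻ p in S, gaussWeight a p.1 * gaussWeight b p.2 ≤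
      ∫⁻ p in rotHalf n ⁻¹' S, gaussWeight (fun i => 2 * a i * b i / (a i + b i)) p.1 *
        gaussWeight (fun i => (a i + b i) / 2) p.2 := by
  set H : Fin n → ℝ := fun i => 2 * a i * b i / (a i + b i) with hH
  set R : Fin n → ℝ := fun i => (a i + b i) / 2 with hR
  have hpres := measurePreserving_rotHalf n
  set S' := rotHalf n ⁻¹' S
  have hS'm : MeasurableSet S' := hpres.measurable hSm
  have hS'c : Convex ℝ S' := hSc.linear_preimage (rotHalf n)
  have hm : ∀ c d : Fin n → ℝ, Measurable fun p : (Fin n → ℝ) × (Fin n → ℝ) =>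
      gaussWeight c p.1 * gaussWeight d p.2 := fun c d =>
    ((measurable_gaussWeight c).comp measurable_fst).mul
      ((measurable_gaussWeight d).comp measurable_snd)
  let w : (Fin n → ℝ) → (Fin n → ℝ) := fun u i => (a i - b i) / (a i + b i) * u i
  have hw : Measurable w := by fun_prop
  have hrot : ∀ p : (Fin n → ℝ) × (Fin n → ℝ),
      gaussWeight a (rotHalf n p).1 * gaussWeight b (rotHalf n p).2 =
      gaussWeight H p.1 * gaussWeight R (p.2 + w p.1) := by
    intro p
    have h : (√2)⁻¹ ^ 2 = (2 : ℝ)⁻¹ := by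
      rw [inv_pow, Real.sq_sqrt zero_le_two]
    simp only [gaussWeight, rotHalf_apply]
    rw [← ENNReal.ofReal_mul (Real.exp_pos _).le, ← ENNReal.ofReal_mul (Real.exp_pos _).le,
      ← Real.exp_add, ← Real.exp_add, ← add_div, ← add_div, ← neg_add, ← neg_add,
      ← Finset.sum_add_distrib, ← Finset.sum_add_distrib]
    congr 4
    refine Finset.sum_congr rfl fun i _ => ?_
    have hab : a i + b i ≠ 0 := (add_pos (ha i) (hb i)).ne'
    simp only [Pi.add_apply, Pi.sub_apply, Pi.smul_apply, smul_eq_mul, mul_pow, h, hH, hR, w]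
    field_simp
    ring
  rw [← hpres.setLIntegral_comp_preimage hSm (hm a b), ← lintegral_indicator hS'm,
    ← lintegral_indicator hS'm, Measure.volume_eq_prod]
  simp only [hrot]
  rw [lintegral_prod, lintegral_prod]
  · refine lintegral_mono fun u => ?_
    dsimp only
    have hL : MeasurableSet (Prod.mk u ⁻¹' S') := measurable_prodMk_left hS'm
    have e : ∀ k : (Fin n → ℝ) → ℝ≥0∞, ∀ φ : (Fin n → ℝ) × (Fin n → ℝ) → ℝ≥0∞,
        (∀ v, φ (u, v) = gaussWeight H u * k v) → ∫⁻ v, S'.indicator φ (u, v) =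
        gaussWeight H u * ∫⁻ v in Prod.mk u ⁻¹' S', k v := by
      intro k φ hφ
      rw [← lintegral_const_mul' _ _ (gaussWeight_ne_top H u), ← lintegral_indicator hL]
      refine lintegral_congr fun v => ?_
      by_cases hv : (u, v) ∈ S'
      · rw [indicator_of_mem hv, indicator_of_mem (by exact hv), hφ]
      · rw [indicator_of_notMem hv, indicator_of_notMem (by exact hv)]
    rw [e (fun v => gaussWeight R (v + w u)) _ fun v => rfl, e (gaussWeight R) _ fun v => rfl]
    refine mul_le_mul' le_rfl ?_
    refine setLIntegral_gaussWeight_add_le (fun i => (half_pos (add_pos (ha i) (hb i))).le) hL ?_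
      (fun v hv => hS.preimage_rotHalf.neg_snd_mem (u, v) hv) (w u)
    intro v hv v' hv' c d hc hd hcd
    have := hS'c (x := (u, v)) hv (y := (u, v')) hv' hc hd hcd
    simpa [← add_smul, hcd] using this
  · exact ((hm H R).indicator hS'm).aemeasurable
  · refine (Measurable.indicator ?_ hS'm).aemeasurable
    exact ((measurable_gaussWeight H).comp measurable_fst).mul
      ((measurable_gaussWeight R).comp (measurable_snd.add (hw.comp measurable_fst)))

lemma tendsto_sqrt_of_harmonic_arithmetic_mean {x y : ℕ → ℝ} (hx : ∀ k, 0 < x k)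
    (hy : ∀ k, 0 < y k) (hxs : ∀ k, x (k + 1) = 2 * x k * y k / (x k + y k))
    (hys : ∀ k, y (k + 1) = (x k + y k) / 2) :
    Tendsto x atTop (𝓝 √(x 0 * y 0)) ∧ Tendsto y atTop (𝓝 √(x 0 * y 0)) := by
  have hprod : ∀ k, x k * y k = x 0 * y 0 := by
    intro k
    induction k with
    | zero => rfl
    | succ k ih =>
      have := (add_pos (hx k) (hy k)).ne'
      rw [hxs, hys, ← ih]
      field_simp
  have hgap : ∀ k, |x k - y k| ≤ |x 0 - y 0| * (1 / 2) ^ k := by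
    intro k
    induction k with
    | zero => simp
    | succ k ih =>
      have hpos := add_pos (hx k) (hy k)
      have hlt : |x k - y k| ≤ x k + y k := by
        rw [abs_le]; constructor <;> linarith [hx k, hy k]
      have e : x (k + 1) - y (k + 1) = -((x k - y k) ^ 2 / (2 * (x k + y k))) := by
        rw [hxs, hys]
        field_simp
        ring
      rw [e, abs_neg, abs_of_nonneg (by positivity), ← sq_abs, div_le_iff₀ (by positivity)]
      calc |x k - y k| ^ 2 = |x k - y k| * |x k - y k| := sq _
        _ ≤ |x 0 - y 0| * (1 / 2) ^ k * (x k + y k) := by gcongr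
        _ = |x 0 - y 0| * (1 / 2) ^ (k + 1) * (2 * (x k + y k)) := by ring
  have hlim : Tendsto (fun k : ℕ => |x 0 - y 0| * (1 / 2 : ℝ) ^ k) atTop (𝓝 0) := by
    simpa using (tendsto_pow_atTop_nhds_zero_of_lt_one (r := (1 / 2 : ℝ)) (by norm_num)
      (by norm_num)).const_mul |x 0 - y 0|
  have hbound : ∀ u v : ℝ, 0 < u → 0 < v → |u - √(u * v)| ≤ |u - v| := by
    intro u v hu hv
    have hs := Real.sqrt_nonneg (u * v)
    have hsq := Real.mul_self_sqrt (mul_pos hu hv).le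
    have e : u - √(u * v) = u / (u + √(u * v)) * (u - v) := by
      field_simp
      linear_combination -hsq
    rw [e, abs_mul, abs_of_nonneg (by positivity)]
    exact mul_le_of_le_one_left (abs_nonneg _) (div_le_one_of_le₀ (by linarith) (by linarith))
  constructor
  · rw [tendsto_iff_dist_tendsto_zero]
    refine squeeze_zero (fun _ => dist_nonneg) (fun k => ?_) hlim
    rw [Real.dist_eq, ← hprod k]
    exact (hbound _ _ (hx k) (hy k)).trans (hgap k)
  · rw [tendsto_iff_dist_tendsto_zero]
    refine squeeze_zero (fun _ => dist_nonneg) (fun k => ?_) hlim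
    rw [Real.dist_eq, ← hprod k, mul_comm]
    exact (hbound _ _ (hy k) (hx k)).trans (abs_sub_comm (x k) (y k) ▸ hgap k)

/-- The pair of the coordinatewise harmonic and arithmetic means. -/
noncomputable def harmArith {n : ℕ} (p : (Fin n → ℝ) × (Fin n → ℝ)) :
    (Fin n → ℝ) × (Fin n → ℝ) :=
  (fun i => 2 * p.1 i * p.2 i / (p.1 i + p.2 i), fun i => (p.1 i + p.2 i) / 2)

lemma harmArith_pos {n : ℕ} {p : (Fin n → ℝ) × (Fin n → ℝ)}
    (hp : ∀ i, 0 < p.1 i ∧ 0 < p.2 i) (i : Fin n) :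
    0 < (harmArith p).1 i ∧ 0 < (harmArith p).2 i := by
  obtain ⟨h1, h2⟩ := hp i
  constructor <;> simp only [harmArith] <;> positivity

lemma iterate_harmArith_pos {n : ℕ} {p : (Fin n → ℝ) × (Fin n → ℝ)}
    (hp : ∀ i, 0 < p.1 i ∧ 0 < p.2 i) (k : ℕ) (i : Fin n) :
    0 < (harmArith^[k] p).1 i ∧ 0 < (harmArith^[k] p).2 i := by
  induction k generalizing i with
  | zero => exact hp i
  | succ k ih => rw [Function.iterate_succ_apply']; exact harmArith_pos ih i

lemma tendsto_iterate_harmArith {n : ℕ} {p : (Fin n → ℝ) × (Fin n → ℝ)}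
    (hp : ∀ i, 0 < p.1 i ∧ 0 < p.2 i) :
    Tendsto (fun k => (harmArith^[k] p).1) atTop (𝓝 fun i => √(p.1 i * p.2 i)) ∧
      Tendsto (fun k => (harmArith^[k] p).2) atTop (𝓝 fun i => √(p.1 i * p.2 i)) := by
  simp only [tendsto_pi_nhds]
  have key := fun i => tendsto_sqrt_of_harmonic_arithmetic_mean
    (x := fun k => (harmArith^[k] p).1 i) (y := fun k => (harmArith^[k] p).2 i)
    (fun k => (iterate_harmArith_pos hp k i).1) (fun k => (iterate_harmArith_pos hp k i).2)
    (fun k => by rw [Function.iterate_succ_apply']; rfl)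
    (fun k => by rw [Function.iterate_succ_apply']; rfl)
  exact ⟨fun i => (key i).1, fun i => (key i).2⟩

lemma tendsto_setLIntegral_gaussWeight {n : ℕ} {K : Set (Fin n → ℝ)} {ι : Type*} {u : Filter ι}
    [u.IsCountablyGenerated] {a : ι → Fin n → ℝ} {b : Fin n → ℝ} (hb : ∀ i, 0 < b i)
    (h : Tendsto a u (𝓝 b)) :
    Tendsto (fun k => ∫⁻ x in K, gaussWeight (a k) x) u (𝓝 (∫⁻ x in K, gaussWeight b x)) := by
  have hev : ∀ᶠ k in u, (fun i => b i / 2) ≤ a k := by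
    refine (eventually_all.2 fun i => ?_ : ∀ᶠ k in u, ∀ i, b i / 2 ≤ a k i)
    exact ((tendsto_pi_nhds.1 h i).eventually (lt_mem_nhds (half_lt_self (hb i)))).mono
      fun k hk => le_of_lt hk
  refine tendsto_lintegral_filter_of_dominated_convergence (gaussWeight fun i => b i / 2)
    (Eventually.of_forall fun k => measurable_gaussWeight (a k))
    (hev.mono fun k hk => ae_of_all _ fun x => gaussWeight_mono hk x) ?_
    (ae_of_all _ fun x => ?_)
  · exact ne_top_of_le_ne_top (lintegral_gaussWeight_ne_top fun i => half_pos (hb i))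
      (lintegral_mono' Measure.restrict_le_self le_rfl)
  · have : Continuous fun c : Fin n → ℝ => gaussWeight c x := by
      unfold gaussWeight
      exact ENNReal.continuous_ofReal.comp (by fun_prop)
    exact (this.tendsto b).comp h

lemma setLIntegral_gaussWeight_mul_le_harmArith {n : ℕ} {K : Set (Fin n → ℝ)}
    (hKm : MeasurableSet K) (hK : Convex ℝ K) (hneg : ∀ x ∈ K, -x ∈ K)
    {p : (Fin n → ℝ) × (Fin n → ℝ)} (hp : ∀ i, 0 < p.1 i ∧ 0 < p.2 i) :
    (∫⁻ x in K, gaussWeight p.1 x) * (∫⁻ x in K, gaussWeight p.2 x) ≤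
      (∫⁻ x in K, gaussWeight (harmArith (harmArith p)).1 x) *
        (∫⁻ x in K, gaussWeight (harmArith (harmArith p)).2 x) := by
  have hprod : ∀ a b : Fin n → ℝ, (∫⁻ x in K, gaussWeight a x) * (∫⁻ x in K, gaussWeight b x) =
      ∫⁻ q in K ×ˢ K, gaussWeight a q.1 * gaussWeight b q.2 := by
    intro a b
    rw [Measure.volume_eq_prod, ← Measure.prod_restrict, lintegral_prod_mul
      (measurable_gaussWeight a).aemeasurable (measurable_gaussWeight b).aemeasurable]
  have hm := hKm.prod hKm
  have hc := hK.prod hK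
  have hs : IsDoublySymmetric (K ×ˢ K) := ⟨fun q hq => ⟨hq.2, hq.1⟩, fun q hq => ⟨hq.1, hneg _ hq.2⟩⟩
  have hq := harmArith_pos hp
  rw [hprod, hprod]
  refine (setLIntegral_gaussWeight_mul_le hm hc hs (fun i => (hp i).1) fun i => (hp i).2).trans ?_
  refine (setLIntegral_gaussWeight_mul_le ((measurePreserving_rotHalf n).measurable hm)
    (hc.linear_preimage (rotHalf n)) hs.preimage_rotHalf (fun i => (hq i).1)
    fun i => (hq i).2).trans_eq ?_
  rw [← preimage_comp, (funext rotHalf_rotHalf : rotHalf n ∘ rotHalf n = id), preimage_id]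
  rfl

/-- The midpoint form of the (B)-inequality for diagonal Gaussians. -/
theorem setLIntegral_gaussWeight_mul_le_sq {n : ℕ} {K : Set (Fin n → ℝ)}
    (hKm : MeasurableSet K) (hK : Convex ℝ K) (hneg : ∀ x ∈ K, -x ∈ K)
    {a b : Fin n → ℝ} (ha : ∀ i, 0 < a i) (hb : ∀ i, 0 < b i) :
    (∫⁻ x in K, gaussWeight a x) * (∫⁻ x in K, gaussWeight b x) ≤
      (∫⁻ x in K, gaussWeight (fun i => √(a i * b i)) x) ^ 2 := by
  have hp : ∀ i, 0 < (a, b).1 i ∧ 0 < (a, b).2 i := fun i => ⟨ha i, hb i⟩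
  have hle : ∀ k : ℕ, (∫⁻ x in K, gaussWeight a x) * (∫⁻ x in K, gaussWeight b x) ≤
      (∫⁻ x in K, gaussWeight (harmArith^[2 * k] (a, b)).1 x) *
        (∫⁻ x in K, gaussWeight (harmArith^[2 * k] (a, b)).2 x) := by
    intro k
    induction k with
    | zero => exact le_rfl
    | succ k ih =>
      refine ih.trans ?_
      rw [mul_add, mul_one, Function.iterate_succ_apply', Function.iterate_succ_apply']
      exact setLIntegral_gaussWeight_mul_le_harmArith hKm hK hneg (iterate_harmArith_pos hp _)
  have hpos : ∀ i, 0 < √(a i * b i) := fun i => Real.sqrt_pos.2 (mul_pos (ha i) (hb i))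
  have h2 : Tendsto (fun k : ℕ => 2 * k) atTop atTop :=
    tendsto_id.const_mul_atTop' two_pos
  obtain ⟨t1, t2⟩ := tendsto_iterate_harmArith hp
  have hfin : ∫⁻ x in K, gaussWeight (fun i => √(a i * b i)) x ≠ ∞ :=
    ne_top_of_le_ne_top (lintegral_gaussWeight_ne_top hpos)
      (lintegral_mono' Measure.restrict_le_self le_rfl)
  rw [sq]
  exact ge_of_tendsto' (ENNReal.Tendsto.mul
    (tendsto_setLIntegral_gaussWeight hpos (t1.comp h2)) (Or.inr hfin)
    (tendsto_setLIntegral_gaussWeight hpos (t2.comp h2)) (Or.inr hfin)) hle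

lemma le_of_continuous_of_midpoint_concave {φ : ℝ → ℝ} (hφ : Continuous φ)
    (hmid : ∀ x y, φ x + φ y ≤ 2 * φ ((x + y) / 2)) {l : ℝ} (h0 : 0 ≤ l) (h1 : l ≤ 1) :
    l * φ 1 + (1 - l) * φ 0 ≤ φ l := by
  set g : ℝ → ℝ := fun x => φ x - (x * φ 1 + (1 - x) * φ 0) with hg
  have hgc : Continuous g := by fun_prop
  have hgmid : ∀ x y, g x + g y ≤ 2 * g ((x + y) / 2) := by
    intro x y
    simp only [hg]
    linarith [hmid x y]
  suffices h : 0 ≤ g l by simp only [hg] at h; linarith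
  obtain ⟨m, hm, hmin⟩ := isCompact_Icc.exists_isMinOn (nonempty_Icc.2 (zero_le_one (α := ℝ)))
    hgc.continuousOn
  by_contra! hlt
  have hgm : g m < 0 := (hmin ⟨h0, h1⟩).trans_lt hlt
  obtain ⟨c, ⟨hcI, hcm⟩, hleast⟩ := (isCompact_Icc.inter_right
    (isClosed_le hgc continuous_const) : IsCompact (Icc (0 : ℝ) 1 ∩ {x | g x ≤ g m})).exists_isLeast
    ⟨m, hm, show g m ≤ g m from le_rfl⟩
  have hcm' : g c ≤ g m := hcm
  have hc0 : c ≠ 0 := by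
    rintro rfl
    simp [hg] at hcm' hgm
    linarith
  have hc1 : c ≠ 1 := by
    rintro rfl
    simp [hg] at hcm' hgm
    linarith
  have hc0' : 0 < c := lt_of_le_of_ne hcI.1 hc0.symm
  have hc1' : c < 1 := lt_of_le_of_ne hcI.2 hc1
  set δ := min c (1 - c)
  have hδ : 0 < δ := lt_min hc0' (by linarith)
  have hδ1 : δ ≤ c := min_le_left _ _
  have hδ2 : δ ≤ 1 - c := min_le_right _ _
  have hleft : g m < g (c - δ) := by
    by_contra! hle
    have := hleast ⟨⟨by linarith, by linarith⟩, hle⟩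
    linarith
  have hright : g m ≤ g (c + δ) := hmin ⟨by linarith, by linarith⟩
  have := hgmid (c - δ) (c + δ)
  rw [show (c - δ + (c + δ)) / 2 = c by ring] at this
  linarith

lemma pi_gaussianReal_eq_withDensity (n : ℕ) :
    Measure.pi (fun _ : Fin n => gaussianReal 0 1) =
      ENNReal.ofReal ((√(2 * Real.pi))⁻¹) ^ n • volume.withDensity (gaussWeight fun _ => 1) := by
  refine Measure.pi_eq fun s hs => ?_
  rw [Measure.smul_apply, withDensity_apply _ (MeasurableSet.univ_pi hs), volume_pi,
    Measure.restrict_pi_pi]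
  simp_rw [gaussWeight_eq_prod]
  rw [lintegral_fin_prod_eq_prod _ (f := fun _ y =>
    ENNReal.ofReal (Real.exp (-(1 / 2) * y ^ 2))) fun i => by fun_prop, smul_eq_mul]
  have : ENNReal.ofReal ((√(2 * Real.pi))⁻¹) ^ n =
      ∏ _i : Fin n, ENNReal.ofReal ((√(2 * Real.pi))⁻¹) := by simp
  rw [this, ← Finset.prod_mul_distrib]
  refine Finset.prod_congr rfl fun i _ => ?_
  rw [gaussianReal_apply _ one_ne_zero, ← lintegral_const_mul' _ _ ENNReal.ofReal_ne_top]
  refine lintegral_congr fun y => ?_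
  rw [gaussianPDF, gaussianPDFReal, ← ENNReal.ofReal_mul (by positivity)]
  congr 3
  · simp
  · simp
    ring

lemma measurable_expScale {n : ℕ} (t : Fin n → ℝ) :
    Measurable fun (x : Fin n → ℝ) i => Real.exp (t i) * x i := by fun_prop

lemma expScale_neg_expScale {n : ℕ} (t x : Fin n → ℝ) :
    (fun i => Real.exp (-t i) * (Real.exp (t i) * x i)) = x := by
  ext i
  rw [← mul_assoc, ← Real.exp_add, neg_add_cancel, Real.exp_zero, one_mul]

lemma expScale_expScale_neg {n : ℕ} (t x : Fin n → ℝ) :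
    (fun i => Real.exp (t i) * (Real.exp (-t i) * x i)) = x := by
  ext i
  rw [← mul_assoc, ← Real.exp_add, add_neg_cancel, Real.exp_zero, one_mul]

lemma image_expScale {n : ℕ} (t : Fin n → ℝ) (K : Set (Fin n → ℝ)) :
    (fun x i => Real.exp (t i) * x i) '' K = (fun x i => Real.exp (-t i) * x i) ⁻¹' K :=
  congrFun (image_eq_preimage_of_inverse (f := fun (x : Fin n → ℝ) i => Real.exp (t i) * x i)
    (g := fun x i => Real.exp (-t i) * x i) (expScale_neg_expScale t) (expScale_expScale_neg t)) K

lemma setLIntegral_image_expScale {n : ℕ} (t : Fin n → ℝ) {K : Set (Fin n → ℝ)}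
    (hK : MeasurableSet K) {φ : (Fin n → ℝ) → ℝ≥0∞} (hφ : Measurable φ) :
    ∫⁻ x in (fun x i => Real.exp (t i) * x i) '' K, φ x =
      ENNReal.ofReal (Real.exp (∑ i, t i)) * ∫⁻ x in K, φ fun i => Real.exp (t i) * x i := by
  have hdet : (Matrix.diagonal fun i => Real.exp (t i)).det = Real.exp (∑ i, t i) := by
    rw [Matrix.det_diagonal, Real.exp_sum]
  have hvol := Real.smul_map_diagonal_volume_pi (D := fun i => Real.exp (t i))
    (by rw [hdet]; exact (Real.exp_pos _).ne')
  have hfun : (Matrix.toLin' (Matrix.diagonal fun i => Real.exp (t i)) : (Fin n → ℝ) → Fin n → ℝ) =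
      fun x i => Real.exp (t i) * x i := by
    ext x i
    simp [Matrix.mulVec_diagonal]
  rw [hdet, abs_of_pos (Real.exp_pos _), hfun] at hvol
  have him : MeasurableSet ((fun x i => Real.exp (t i) * x i) '' K) := by
    rw [image_expScale]
    exact measurable_expScale (fun i => -t i) hK
  have hpre : (fun (x : Fin n → ℝ) i => Real.exp (t i) * x i) ⁻¹'
      ((fun x i => Real.exp (t i) * x i) '' K) = K :=
    preimage_image_eq _ (Function.LeftInverse.injective
      (g := fun (x : Fin n → ℝ) i => Real.exp (-t i) * x i) (expScale_neg_expScale t))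
  conv_lhs => rw [← hvol]
  rw [Measure.restrict_smul, lintegral_smul_measure, setLIntegral_map him hφ
    (measurable_expScale t), hpre, smul_eq_mul]

lemma pi_gaussianReal_image_expScale {n : ℕ} (t : Fin n → ℝ) {K : Set (Fin n → ℝ)}
    (hK : MeasurableSet K) :
    Measure.pi (fun _ : Fin n => gaussianReal 0 1) ((fun x i => Real.exp (t i) * x i) '' K) =
      ENNReal.ofReal ((√(2 * Real.pi))⁻¹) ^ n * (ENNReal.ofReal (Real.exp (∑ i, t i)) *
        ∫⁻ x in K, gaussWeight (fun i => Real.exp (2 * t i)) x) := by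
  have him : MeasurableSet ((fun x i => Real.exp (t i) * x i) '' K) := by
    rw [image_expScale]
    exact measurable_expScale (fun i => -t i) hK
  rw [pi_gaussianReal_eq_withDensity, Measure.smul_apply, withDensity_apply _ him,
    setLIntegral_image_expScale t hK (measurable_gaussWeight _), smul_eq_mul]
  have hw : ∀ x : Fin n → ℝ, (gaussWeight (fun _ => 1) fun i => Real.exp (t i) * x i) =
      gaussWeight (fun i => Real.exp (2 * t i)) x := fun x => by
    simp only [gaussWeight, one_mul, mul_pow, ← Real.exp_nat_mul, Nat.cast_ofNat]
  simp_rw [hw]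

lemma continuous_pi_gaussianReal_image_expScale {n : ℕ} {K : Set (Fin n → ℝ)}
    (hK : MeasurableSet K) :
    Continuous fun t : Fin n → ℝ =>
      Measure.pi (fun _ : Fin n => gaussianReal 0 1) ((fun x i => Real.exp (t i) * x i) '' K) := by
  simp_rw [pi_gaussianReal_image_expScale _ hK]
  refine ENNReal.continuous_const_mul (ENNReal.pow_ne_top ENNReal.ofReal_ne_top) |>.comp ?_
  refine continuous_iff_continuousAt.2 fun t => ?_
  have hpos : ∀ i, 0 < Real.exp (2 * t i) := fun i => Real.exp_pos _
  have h1 : Continuous fun t : Fin n → ℝ => ENNReal.ofReal (Real.exp (∑ i, t i)) :=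
    ENNReal.continuous_ofReal.comp (by fun_prop)
  have h2 : Continuous fun (t : Fin n → ℝ) i => Real.exp (2 * t i) := by fun_prop
  exact ENNReal.Tendsto.mul (h1.tendsto t) (Or.inr <|
    ne_top_of_le_ne_top (lintegral_gaussWeight_ne_top hpos)
      (lintegral_mono' Measure.restrict_le_self le_rfl))
    (tendsto_setLIntegral_gaussWeight hpos (h2.tendsto t)) (Or.inr ENNReal.ofReal_ne_top)

lemma pi_gaussianReal_image_expScale_eq_zero_iff {n : ℕ} (t : Fin n → ℝ) {K : Set (Fin n → ℝ)}
    (hK : MeasurableSet K) :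
    Measure.pi (fun _ : Fin n => gaussianReal 0 1) ((fun x i => Real.exp (t i) * x i) '' K) = 0 ↔
      volume K = 0 := by
  have hc : ENNReal.ofReal ((√(2 * Real.pi))⁻¹) ≠ 0 := by
    simpa using Real.pi_pos
  have hpos : ∀ x, gaussWeight (fun i => Real.exp (2 * t i)) x ≠ 0 := fun x => by
    simpa [gaussWeight] using Real.exp_pos _
  rw [pi_gaussianReal_image_expScale t hK, mul_eq_zero, or_iff_right (pow_ne_zero _ hc),
    mul_eq_zero, or_iff_right (by simpa using Real.exp_pos _),
    lintegral_eq_zero_iff (measurable_gaussWeight _), Filter.EventuallyEq, ae_iff,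
    ← Measure.restrict_apply_univ K]
  refine Eq.congr_left (congrArg _ (eq_univ_of_forall fun x => ?_))
  exact hpos x

lemma pi_gaussianReal_image_expScale_mul_le_sq {n : ℕ} (s t : Fin n → ℝ) {K : Set (Fin n → ℝ)}
    (hKm : MeasurableSet K) (hK : Convex ℝ K) (hneg : ∀ x ∈ K, -x ∈ K) :
    Measure.pi (fun _ : Fin n => gaussianReal 0 1) ((fun x i => Real.exp (s i) * x i) '' K) *
        Measure.pi (fun _ : Fin n => gaussianReal 0 1) ((fun x i => Real.exp (t i) * x i) '' K) ≤
      Measure.pi (fun _ : Fin n => gaussianReal 0 1)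
        ((fun x i => Real.exp ((s i + t i) / 2) * x i) '' K) ^ 2 := by
  have key := setLIntegral_gaussWeight_mul_le_sq hKm hK hneg (fun i => Real.exp_pos (2 * s i))
    fun i => Real.exp_pos (2 * t i)
  have hsqrt : (fun i => √(Real.exp (2 * s i) * Real.exp (2 * t i))) =
      fun i => Real.exp (2 * ((s i + t i) / 2)) := by
    ext i
    rw [← Real.exp_add, ← Real.exp_half]
    ring_nf
  have hexp : ENNReal.ofReal (Real.exp (∑ i, (s i + t i) / 2)) ^ 2 =
      ENNReal.ofReal (Real.exp (∑ i, s i)) * ENNReal.ofReal (Real.exp (∑ i, t i)) := by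
    rw [← ENNReal.ofReal_pow (Real.exp_pos _).le, ← ENNReal.ofReal_mul (Real.exp_pos _).le,
      ← Real.exp_nat_mul, ← Real.exp_add, ← Finset.sum_div, Finset.sum_add_distrib]
    congr 2
    push_cast
    ring
  rw [hsqrt] at key
  rw [pi_gaussianReal_image_expScale _ hKm, pi_gaussianReal_image_expScale _ hKm,
    pi_gaussianReal_image_expScale (fun i => (s i + t i) / 2) hKm, mul_pow, mul_pow, hexp]
  refine le_trans (le_of_eq ?_) (mul_le_mul_right (mul_le_mul_right key _) _)
  ring

/-- The (B)-inequality for the standard Gaussian measure. -/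
theorem pi_gaussianReal_image_expScale_rpow_mul_le {n : ℕ} (s t : Fin n → ℝ) {l : ℝ} (h0 : 0 < l)
    (h1 : l < 1) {K : Set (Fin n → ℝ)} (hKm : MeasurableSet K) (hK : Convex ℝ K)
    (hneg : ∀ x ∈ K, -x ∈ K) :
    Measure.pi (fun _ : Fin n => gaussianReal 0 1)
          ((fun x i => Real.exp (s i) * x i) '' K) ^ l *
        Measure.pi (fun _ : Fin n => gaussianReal 0 1)
          ((fun x i => Real.exp (t i) * x i) '' K) ^ (1 - l) ≤
      Measure.pi (fun _ : Fin n => gaussianReal 0 1)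
        ((fun x i => Real.exp (l * s i + (1 - l) * t i) * x i) '' K) := by
  set F : (Fin n → ℝ) → ℝ≥0∞ := fun t =>
    Measure.pi (fun _ : Fin n => gaussianReal 0 1) ((fun x i => Real.exp (t i) * x i) '' K) with hF
  suffices h : F s ^ l * F t ^ (1 - l) ≤ F fun i => l * s i + (1 - l) * t i from h
  by_cases hvol : volume K = 0
  · have : F s = 0 := (pi_gaussianReal_image_expScale_eq_zero_iff s hKm).2 hvol
    simp [this, h0]
  have hpos : ∀ t, 0 < (F t).toReal := fun t => ENNReal.toReal_pos
    (mt (pi_gaussianReal_image_expScale_eq_zero_iff t hKm).1 hvol) (measure_ne_top _ _)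
  have hFc : Continuous fun t => (F t).toReal :=
    ENNReal.continuousOn_toReal.comp_continuous (continuous_pi_gaussianReal_image_expScale hKm)
      fun t => measure_ne_top _ _
  have key := le_of_continuous_of_midpoint_concave
    (φ := fun x => Real.log (F fun i => x * s i + (1 - x) * t i).toReal)
    ((hFc.comp (by fun_prop)).log fun x => (hpos _).ne') (fun x y => ?_) h0.le h1.le
  · simp only [one_mul, sub_self, zero_mul, add_zero, sub_zero, zero_add] at key
    rw [← ENNReal.toReal_le_toReal
      (ENNReal.mul_ne_top (ENNReal.rpow_ne_top_of_nonneg h0.le (measure_ne_top _ _))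
        (ENNReal.rpow_ne_top_of_nonneg (sub_pos.2 h1).le (measure_ne_top _ _)))
      (measure_ne_top _ _), ENNReal.toReal_mul, ← ENNReal.toReal_rpow, ← ENNReal.toReal_rpow,
      ← Real.log_le_log_iff (mul_pos (Real.rpow_pos_of_pos (hpos _) _)
        (Real.rpow_pos_of_pos (hpos _) _)) (hpos _), Real.log_mul
        (Real.rpow_pos_of_pos (hpos _) _).ne' (Real.rpow_pos_of_pos (hpos _) _).ne',
      Real.log_rpow (hpos _), Real.log_rpow (hpos _)]
    exact key
  · have hmid := ENNReal.toReal_mono (ENNReal.pow_ne_top (measure_ne_top _ _))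
      (pi_gaussianReal_image_expScale_mul_le_sq (fun i => x * s i + (1 - x) * t i)
        (fun i => y * s i + (1 - y) * t i) hKm hK hneg)
    rw [ENNReal.toReal_mul, ENNReal.toReal_pow] at hmid
    have hlog := Real.log_le_log (mul_pos (hpos _) (hpos _)) hmid
    rw [Real.log_mul (hpos _).ne' (hpos _).ne', Real.log_pow] at hlog
    refine hlog.trans_eq ?_
    rw [Nat.cast_ofNat]
    congr! 6
    ring_nf

lemma pi_eq_map_expScale {n : ℕ} {ν : Fin n → Measure ℝ} [∀ i, IsProbabilityMeasure (ν i)]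
    (hν : ∀ i, ∀ᵐ y ∂(ν i), 0 < y) {ρ : Measure ℝ} [IsProbabilityMeasure ρ] :
    Measure.pi (fun i => ((ν i).prod ρ).map fun p => p.1 * p.2) =
      ((Measure.pi fun i => (ν i).map Real.log).prod (Measure.pi fun _ => ρ)).map
        fun p i => Real.exp (p.1 i) * p.2 i := by
  have hlog : ∀ i, IsProbabilityMeasure ((ν i).map Real.log) := fun i =>
    Measure.isProbabilityMeasure_map Real.measurable_log.aemeasurable
  have hprob : ∀ i, IsProbabilityMeasure (((ν i).prod ρ).map fun p => p.1 * p.2) := fun i =>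
    Measure.isProbabilityMeasure_map (by fun_prop)
  have hmap : ∀ i, MeasurePreserving (fun p : ℝ × ℝ => Real.exp p.1 * p.2)
      (((ν i).map Real.log).prod ρ) (((ν i).prod ρ).map fun p => p.1 * p.2) := by
    refine fun i => ⟨by fun_prop, ?_⟩
    have h := Measure.map_prod_map (ν i) ρ Real.measurable_log measurable_id
    rw [Measure.map_id] at h
    rw [h, Measure.map_map (by fun_prop) (Real.measurable_log.prodMap measurable_id)]
    refine Measure.map_congr ?_
    filter_upwards [Measure.quasiMeasurePreserving_fst.ae (hν i)] with p hp
    simp [Real.exp_log hp]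
  have h1 := measurePreserving_pi _ _ hmap
  have h2 := (measurePreserving_arrowProdEquivProdArrow ℝ ℝ (Fin n)
    (fun i => (ν i).map Real.log) fun _ => ρ).symm
  exact (h1.comp h2).map_eq.symm

lemma image_expScale_sub {n : ℕ} (s u : Fin n → ℝ) (K : Set (Fin n → ℝ)) :
    (fun x i => Real.exp (u i) * x i) ⁻¹' ((fun x i => Real.exp (s i) * x i) '' K) =
      (fun x i => Real.exp (s i - u i) * x i) '' K := by
  rw [image_expScale, image_expScale (fun i => s i - u i), ← preimage_comp]
  congr 1
  ext x i
  simp only [Function.comp_apply, ← mul_assoc, ← Real.exp_add]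
  ring_nf

lemma pi_image_expScale_eq_lintegral {n : ℕ} {ν : Fin n → Measure ℝ}
    [∀ i, IsProbabilityMeasure (ν i)] (hν : ∀ i, ∀ᵐ y ∂(ν i), 0 < y) {ρ : Measure ℝ}
    [IsProbabilityMeasure ρ] (t : Fin n → ℝ) {K : Set (Fin n → ℝ)} (hK : MeasurableSet K) :
    Measure.pi (fun i => ((ν i).prod ρ).map fun p => p.1 * p.2)
        ((fun x i => Real.exp (t i) * x i) '' K) =
      ∫⁻ u, Measure.pi (fun _ => ρ) ((fun x i => Real.exp (t i - u i) * x i) '' K)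
        ∂(Measure.pi fun i => (ν i).map Real.log) := by
  have him : MeasurableSet ((fun x i => Real.exp (t i) * x i) '' K) := by
    rw [image_expScale]
    exact measurable_expScale (fun i => -t i) hK
  have hm : Measurable fun (p : (Fin n → ℝ) × (Fin n → ℝ)) i => Real.exp (p.1 i) * p.2 i := by
    fun_prop
  rw [pi_eq_map_expScale hν, Measure.map_apply hm him, Measure.prod_apply (hm him)]
  refine lintegral_congr fun u => ?_
  rw [← image_expScale_sub]
  rfl

lemma pi_image_expScale_closure {n : ℕ} {ν : Fin n → Measure ℝ}
    [∀ i, IsProbabilityMeasure (ν i)] (hν : ∀ i, ∀ᵐ y ∂(ν i), 0 < y) {K : Set (Fin n → ℝ)}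
    (hK : Convex ℝ K) (t : Fin n → ℝ) :
    Measure.pi (fun i => ((ν i).prod (gaussianReal 0 1)).map fun p => p.1 * p.2)
        ((fun x i => Real.exp (t i) * x i) '' closure K) =
      Measure.pi (fun i => ((ν i).prod (gaussianReal 0 1)).map fun p => p.1 * p.2)
        ((fun x i => Real.exp (t i) * x i) '' K) := by
  have hfr := hK.addHaar_frontier volume
  have hfrm : MeasurableSet (frontier K) := isClosed_frontier.measurableSet
  refine le_antisymm ?_ (measure_mono (image_mono subset_closure))
  rw [closure_eq_self_union_frontier, image_union]
  refine (measure_union_le _ _).trans_eq ?_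
  rw [pi_image_expScale_eq_lintegral hν t hfrm]
  simp [(pi_gaussianReal_image_expScale_eq_zero_iff _ hfrm).2 hfr]

/-- **Theorem 9 (B-inequality for Gaussian mixtures).** If `Xᵢ = YᵢZᵢ` are independent Gaussian
mixtures with each `log Yᵢ` log-concave, `μᵢ` is the law of `Xᵢ` and `μ = μ₁ × ⋯ × μₙ`, then
for every symmetric convex `K ⊆ ℝⁿ` the map `(t₁,…,tₙ) ↦ μ(Δ(e^{t₁},…,e^{tₙ})K)` is
log-concave on `ℝⁿ`. -/
theorem B_inequality_gaussianMixtures {n : ℕ}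
    (ν : Fin n → Measure ℝ) (hνprob : ∀ i, IsProbabilityMeasure (ν i))
    (hνpos : ∀ i, ∀ᵐ y ∂(ν i), 0 < y)
    (hlogconc : ∀ i, IsLogConcaveMeasure ((ν i).map Real.log))
    (μ : Fin n → Measure ℝ)
    (hμ : ∀ i, μ i = ((ν i).prod (gaussianReal 0 1)).map (fun p => p.1 * p.2))
    (K : Set (Fin n → ℝ)) (hK : Convex ℝ K) (hKsymm : K = -K) :
    ∀ s t : Fin n → ℝ, ∀ l : ℝ, 0 < l → l < 1 →
      Measure.pi μ ((fun x i => Real.exp (s i) * x i) '' K) ^ l *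
        Measure.pi μ ((fun x i => Real.exp (t i) * x i) '' K) ^ (1 - l) ≤
      Measure.pi μ ((fun x i => Real.exp (l * s i + (1 - l) * t i) * x i) '' K) := by
  intro s t l h0 h1
  obtain rfl : μ = fun i => ((ν i).prod (gaussianReal 0 1)).map fun p => p.1 * p.2 := funext hμ
  have hlog : ∀ i, IsProbabilityMeasure ((ν i).map Real.log) := fun i =>
    Measure.isProbabilityMeasure_map Real.measurable_log.aemeasurable
  have hneg : ∀ x ∈ closure K, -x ∈ closure K := fun x hx => by
    rw [← Set.mem_neg, neg_closure, ← hKsymm]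
    exact hx
  have hKm : MeasurableSet (closure K) := isClosed_closure.measurableSet
  have hPL : SatisfiesPrekopaLeindler (Measure.pi fun i => (ν i).map Real.log) :=
    SatisfiesPrekopaLeindler.pi fun i => (hlogconc i).satisfiesPrekopaLeindler
  have hmeas : ∀ t : Fin n → ℝ, Measurable fun u : Fin n → ℝ =>
      Measure.pi (fun _ : Fin n => gaussianReal 0 1)
        ((fun x i => Real.exp (t i - u i) * x i) '' closure K) := fun t =>
    ((continuous_pi_gaussianReal_image_expScale hKm).comp (continuous_sub_left t)).measurable
  rw [← pi_image_expScale_closure hνpos hK, ← pi_image_expScale_closure hνpos hK,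
    ← pi_image_expScale_closure hνpos hK fun i => l * s i + (1 - l) * t i,
    pi_image_expScale_eq_lintegral hνpos s hKm, pi_image_expScale_eq_lintegral hνpos t hKm,
    pi_image_expScale_eq_lintegral hνpos (fun i => l * s i + (1 - l) * t i) hKm]
  refine hPL l h0 h1 _ _ _ (hmeas _) (hmeas _) (hmeas _) fun u v => ?_
  refine (pi_gaussianReal_image_expScale_rpow_mul_le (fun i => s i - u i) (fun i => t i - v i)
    h0 h1 hKm hK.closure hneg).trans_eq ?_
  have he : ∀ i, l * (s i - u i) + (1 - l) * (t i - v i) =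
      l * s i + (1 - l) * t i - (l • u + (1 - l) • v) i := fun i => by
    simp only [Pi.add_apply, Pi.smul_apply, smul_eq_mul]
    ring
  simp_rw [he]
end

section
/- Fix p ∈ (0,2) and let Z be a standard Gaussian random variable. If V has density proportional to t^{-1/2} g_{p/2}(t) on (0,∞), where g_{p/2} is the density of a standard positive (p/2)-stable random variable, and V is independent of Z, then the random variable (2V)^{-1/2} Z has density c_p e^{-|t|^p} on ℝ, where c_p = (2Γ(1+1/p))^{-1}. -/
open MeasureTheory ProbabilityTheory

/-- The law of `(2v)^{-1/2} Z`, with `Z` standard Gaussian, has density `√(v/π) e^{-t²v}`. -/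
lemma gaussianReal_preimage_rpow_mul {v : ℝ} (hv : 0 < v) {A : Set ℝ} (hA : MeasurableSet A) :
    gaussianReal 0 1 ((fun z => (2 * v) ^ (-(1 : ℝ) / 2) * z) ⁻¹' A)
      = ∫⁻ t in A, ENNReal.ofReal (√(v / Real.pi) * Real.exp (-(t ^ 2 * v))) := by
  set a : ℝ := (2 * v) ^ (-(1 : ℝ) / 2) with ha
  have ha0 : 0 < a := by positivity
  have ha2 : a ^ 2 = (2 * v)⁻¹ := by
    rw [ha, ← Real.rpow_natCast, ← Real.rpow_mul (by positivity), ← Real.rpow_neg_one]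
    norm_num
  rw [← Measure.map_apply (by fun_prop) hA, gaussianReal_map_const_mul, mul_zero,
    gaussianReal_apply]
  · refine lintegral_congr fun t => ?_
    have hvar : ((NNReal.mk (a ^ 2) (sq_nonneg _) * 1 : NNReal) : ℝ) = (2 * v)⁻¹ := by
      simp [ha2]
    rw [gaussianPDF, gaussianPDFReal, hvar, ← Real.sqrt_inv]
    congr 3
    · field_simp
    · field_simp
      ring
  · rw [mul_one, ne_eq, ← NNReal.coe_eq_zero]
    exact (pow_pos ha0 2).ne'

/-- The function `c e^{-|t|^p}` has total mass `2 c Γ(1 + 1/p)`. -/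
lemma lintegral_const_mul_exp_neg_abs_rpow {p K : ℝ} (hp : 0 < p) (hK : 0 ≤ K) :
    ∫⁻ t : ℝ, ENNReal.ofReal (K * Real.exp (-|t| ^ p))
      = ENNReal.ofReal (K * (2 * Real.Gamma (1 + 1 / p))) := by
  have hΓ : 0 < Real.Gamma (1 / p + 1) := Real.Gamma_pos_of_pos (by positivity)
  have hint : ∫ t : ℝ, Real.exp (-|t| ^ p) = 2 * Real.Gamma (1 + 1 / p) := by
    rw [integral_comp_abs (f := fun x => Real.exp (-x ^ p)), integral_exp_neg_rpow hp, add_comm]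
  have hI : Integrable fun t : ℝ => Real.exp (-|t| ^ p) := by
    by_contra h
    rw [integral_undef h, add_comm] at hint
    linarith
  rw [← hint, ← integral_const_mul,
    ofReal_integral_eq_lintegral_ofReal (hI.const_mul K) (ae_of_all _ fun t => by positivity)]

/-- If `K e^{-|t|^p}` is a probability density, then `K = (2Γ(1 + 1/p))⁻¹`. -/
lemma eq_inv_two_mul_Gamma_of_lintegral_eq_one {p K : ℝ} (hp : 0 < p) (hK : 0 ≤ K)
    (h : ∫⁻ t : ℝ, ENNReal.ofReal (K * Real.exp (-|t| ^ p)) = 1) :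
    K = (2 * Real.Gamma (1 + 1 / p))⁻¹ := by
  rw [lintegral_const_mul_exp_neg_abs_rpow hp hK, ENNReal.ofReal_eq_one] at h
  exact eq_inv_of_mul_eq_one_left h

/-- If `V` has density `c v^{-1/2} g(v)`, then the Gaussian mixture `(2V)^{-1/2} Z` has density at `t`
equal to `c / √π` times the Laplace transform of `g` at `t²`. -/
lemma map_rpow_mul_gaussian_eq_withDensity
    {Ω : Type*} {mΩ : MeasurableSpace Ω} {μ : Measure Ω} [IsProbabilityMeasure μ]
    {g L : ℝ → ℝ} (hg0 : ∀ x, 0 ≤ g x)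
    (hint : ∀ t : ℝ, 0 ≤ t →
      IntegrableOn (fun x => Real.exp (-(t * x)) * g x) (Set.Ioi (0 : ℝ)))
    (hL : ∀ t : ℝ, 0 ≤ t → ∫ x in Set.Ioi (0 : ℝ), Real.exp (-(t * x)) * g x = L t)
    {V Z : Ω → ℝ} (hV : Measurable V) (hZ : Measurable Z) (hindep : IndepFun V Z μ)
    (hZlaw : μ.map Z = gaussianReal 0 1) {c : ℝ} (hc : 0 < c)
    (hVlaw : μ.map V = (volume.restrict (Set.Ioi (0 : ℝ))).withDensity
      (fun x => ENNReal.ofReal (c * x ^ (-(1 : ℝ) / 2) * g x))) :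
    μ.map (fun ω => (2 * V ω) ^ (-(1 : ℝ) / 2) * Z ω)
      = volume.withDensity (fun t => ENNReal.ofReal (c / √Real.pi * L (t ^ 2))) := by
  have hgm : AEMeasurable g (volume.restrict (Set.Ioi (0 : ℝ))) := by
    simpa using (hint 0 le_rfl).aemeasurable
  have hφ : Measurable fun q : ℝ × ℝ => (2 * q.1) ^ (-(1 : ℝ) / 2) * q.2 := by fun_prop
  ext A hA
  have hmeas : AEMeasurable (fun x => ENNReal.ofReal (c * x ^ (-(1 : ℝ) / 2) * g x))
      (volume.restrict (Set.Ioi (0 : ℝ))) := by fun_prop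
  calc μ.map (fun ω => (2 * V ω) ^ (-(1 : ℝ) / 2) * Z ω) A
      = ((μ.map V).prod (μ.map Z)) ((fun q => (2 * q.1) ^ (-(1 : ℝ) / 2) * q.2) ⁻¹' A) := by
        rw [← (indepFun_iff_map_prod_eq_prod_map_map hV.aemeasurable hZ.aemeasurable).1 hindep,
          ← Measure.map_apply hφ hA, Measure.map_map hφ (hV.prodMk hZ)]
        rfl
    _ = ∫⁻ v in Set.Ioi (0 : ℝ), ENNReal.ofReal (c * v ^ (-(1 : ℝ) / 2) * g v)
          * gaussianReal 0 1 ((fun z => (2 * v) ^ (-(1 : ℝ) / 2) * z) ⁻¹' A) := by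
        have hsec := measurable_measure_prodMk_left (ν := gaussianReal 0 1) (hφ hA)
        rw [hZlaw, Measure.prod_apply (hφ hA), hVlaw,
          lintegral_withDensity_eq_lintegral_mul₀ hmeas hsec.aemeasurable]
        rfl
    _ = ∫⁻ v in Set.Ioi (0 : ℝ), ∫⁻ t in A,
          ENNReal.ofReal (c / √Real.pi * (Real.exp (-(t ^ 2 * v)) * g v)) := by
        refine setLIntegral_congr_fun measurableSet_Ioi fun v (hv : 0 < v) => ?_
        rw [gaussianReal_preimage_rpow_mul hv hA, ← lintegral_const_mul _ (by fun_prop)]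
        refine lintegral_congr fun t => ?_
        have hg := hg0 v
        rw [← ENNReal.ofReal_mul (by positivity), Real.sqrt_div hv.le, neg_div,
          Real.rpow_neg hv.le, ← Real.sqrt_eq_rpow]
        congr 1
        field_simp
    _ = ∫⁻ t in A, ∫⁻ v in Set.Ioi (0 : ℝ),
          ENNReal.ofReal (c / √Real.pi * (Real.exp (-(t ^ 2 * v)) * g v)) := by
        refine lintegral_lintegral_swap ?_
        have hg1 : AEMeasurable (fun q : ℝ × ℝ => g q.1)
            ((volume.restrict (Set.Ioi (0 : ℝ))).prod (volume.restrict A)) := hgm.comp_fst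
        unfold Function.uncurry
        fun_prop
    _ = volume.withDensity (fun t => ENNReal.ofReal (c / √Real.pi * L (t ^ 2))) A := by
        rw [withDensity_apply _ hA]
        refine lintegral_congr fun t => ?_
        rw [← hL _ (sq_nonneg t), ← integral_const_mul, ofReal_integral_eq_lintegral_ofReal
          ((hint _ (sq_nonneg t)).const_mul _)
          (ae_of_all _ fun v => by have := hg0 v; positivity)]

/-- **Lemma 18(i).** Fix `p ∈ (0,2)`, let `g_{p/2}` be the density of a standard positive
`(p/2)`-stable random variable (one with Laplace transform `e^{-t^{p/2}}`), let `V` have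
density proportional to `t^{-1/2} g_{p/2}(t)` on `(0,∞)` and let `Z` be an independent
standard Gaussian. Then `(2V)^{-1/2} Z` has density `c_p e^{-|t|^p}`,
`c_p = (2Γ(1+1/p))⁻¹`. -/
theorem density_exp_abs_rpow_is_gaussian_mixture
    {Ω : Type*} [MeasureSpace Ω] [IsProbabilityMeasure (ℙ : Measure Ω)]
    (p : ℝ) (hp0 : 0 < p) (hp2 : p < 2)
    (g : ℝ → ℝ) (hg0 : ∀ x, 0 ≤ g x)
    (hgdens : IsProbabilityMeasure
      ((volume.restrict (Set.Ioi (0 : ℝ))).withDensity (fun x => ENNReal.ofReal (g x))))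
    (hstable : ∀ t : ℝ, 0 ≤ t →
      ∫ x in Set.Ioi (0 : ℝ), Real.exp (-(t * x)) * g x = Real.exp (-(t ^ (p / 2))))
    (V Z : Ω → ℝ) (hV : Measurable V) (hZ : Measurable Z)
    (hindep : IndepFun V Z ℙ)
    (hZlaw : (ℙ : Measure Ω).map Z = gaussianReal 0 1)
    (c : ℝ) (hc : 0 < c)
    (hVlaw : (ℙ : Measure Ω).map V = (volume.restrict (Set.Ioi (0 : ℝ))).withDensity
      (fun x => ENNReal.ofReal (c * x ^ (-(1 : ℝ) / 2) * g x))) :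
    (ℙ : Measure Ω).map (fun ω => (2 * V ω) ^ (-(1 : ℝ) / 2) * Z ω)
      = volume.withDensity
          (fun t => ENNReal.ofReal ((2 * Real.Gamma (1 + 1 / p))⁻¹ * Real.exp (-|t| ^ p))) := by
  have hint : ∀ t : ℝ, 0 ≤ t →
      IntegrableOn (fun x => Real.exp (-(t * x)) * g x) (Set.Ioi (0 : ℝ)) := fun t ht =>
    Integrable.of_integral_ne_zero (by rw [hstable t ht]; exact (Real.exp_pos _).ne')
  have hL : ∀ t : ℝ, (t ^ 2) ^ (p / 2) = |t| ^ p := fun t => by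
    rw [← sq_abs, ← Real.rpow_natCast, ← Real.rpow_mul (abs_nonneg t)]
    congr 1
    push_cast
    ring
  have hmix := map_rpow_mul_gaussian_eq_withDensity hg0 hint hstable hV hZ hindep hZlaw hc hVlaw
  simp_rw [hL] at hmix
  have hprob : IsProbabilityMeasure
      ((ℙ : Measure Ω).map (fun ω => (2 * V ω) ^ (-(1 : ℝ) / 2) * Z ω)) :=
    Measure.isProbabilityMeasure_map (by fun_prop)
  have hmass := hprob.measure_univ
  rw [hmix, withDensity_apply _ MeasurableSet.univ, Measure.restrict_univ] at hmass
  rw [hmix, eq_inv_two_mul_Gamma_of_lintegral_eq_one hp0 (by positivity) hmass]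
end
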